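/- Let X₁,...,X_n be i.i.d. uniform points on the circle of circumference 1 and let r ∈ (0,1). The expected Euler characteristic of the Čech complex at filtration radius (1−r)/2 (built from intrinsic circle arcs) equals Σ_{k=1}^{⌊1/r⌋} C(n,k) (1−kr)^{k−1} (kr)^{n−k}. -/

import Mathlib

open MeasureTheory
open scoped Classical

/-- The Euler characteristic of the Čech complex (nerve of closed arcs of radius `s`
centered at the points `x i`) of a finite point configuration on the circle `ℝ/ℤ`:
the alternating sum `Σ_σ (-1)^(|σ|-1)` over nonempty simplices `σ`. -/
noncomputable def cechEuler {n : ℕ} (x : Fin n → AddCircle (1:ℝ)) (s : ℝ) : ℝ :=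
  ∑ σ ∈ Finset.univ.powerset.filter (fun σ : Finset (Fin n) => σ.Nonempty),
    if ∃ c : AddCircle (1:ℝ), ∀ i ∈ σ, dist c (x i) ≤ s then (-1 : ℝ) ^ (σ.card - 1) else 0


lemma comb_aux {n : ℕ} (s : Finset (Fin n)) (P : Fin n → Prop)
    [d1 : ∀ J : Finset (Fin n), Decidable (∀ i ∈ J, P i)] [d2 : Decidable (∃ i ∈ s, P i)] :
    ∑ J ∈ s.powerset, (-1:ℝ)^J.card * (if ∀ i ∈ J, P i then 1 else 0)
      = if ∃ i ∈ s, P i then 0 else 1 := by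
  have h := Finset.prod_add (fun i => -(if P i then (1:ℝ) else 0)) (fun _ => (1:ℝ)) s
  have h2 : ∀ J ∈ s.powerset, (-1:ℝ)^J.card * (if ∀ i ∈ J, P i then 1 else 0)
      = (∏ i ∈ J, -(if P i then (1:ℝ) else 0)) * ∏ i ∈ s \ J, (1:ℝ) := by
    intro J _
    rw [Finset.prod_const_one, mul_one, Finset.prod_neg, Finset.prod_ite_zero]
    by_cases hp : ∀ i ∈ J, P i
    · rw [if_pos hp, if_pos hp]; simp
    · rw [if_neg hp, if_neg hp]
  rw [Finset.sum_congr rfl h2, ← h]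
  split_ifs with hh
  · obtain ⟨i, hi, hp⟩ := hh
    exact Finset.prod_eq_zero hi (by simp [hp])
  · push Not at hh
    exact Finset.prod_eq_one (fun i hi => by simp [hh i hi])

lemma comb {n : ℕ} (R : Fin n → Fin n → Prop) :
    (∑ σ ∈ Finset.univ.powerset.filter (fun σ : Finset (Fin n) => σ.Nonempty),
      if ∃ i ∈ σ, ∀ j ∈ σ, ¬ R i j then (-1 : ℝ) ^ (σ.card - 1) else 0)
    = ∑ J ∈ Finset.univ.powerset.filter (fun σ : Finset (Fin n) => σ.Nonempty),
      if (∀ i ∈ J, ∀ j ∈ J, ¬ R i j) ∧ (∀ l, l ∉ J → ∃ i ∈ J, R i l) then (1:ℝ) else 0 := by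
  have h1 : ∀ σ ∈ Finset.univ.powerset.filter (fun σ : Finset (Fin n) => σ.Nonempty),
      (if ∃ i ∈ σ, ∀ j ∈ σ, ¬ R i j then (-1 : ℝ) ^ (σ.card - 1) else 0)
      = ∑ J ∈ Finset.univ.powerset.filter (fun σ : Finset (Fin n) => σ.Nonempty),
        if J ⊆ σ then (-1:ℝ)^(σ.card + J.card) *
          (if ∀ i ∈ J, ∀ j ∈ σ, ¬ R i j then 1 else 0) else 0 := by
    intro σ hσ
    have hne : σ.Nonempty := by simpa using hσ
    have h := comb_aux σ (fun i => ∀ j ∈ σ, ¬ R i j)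
    have h3 : ∑ J ∈ Finset.univ.powerset.filter (fun σ : Finset (Fin n) => σ.Nonempty),
        (if J ⊆ σ then (-1:ℝ)^(σ.card + J.card) *
          (if ∀ i ∈ J, ∀ j ∈ σ, ¬ R i j then 1 else 0) else 0)
        = (-1:ℝ)^σ.card * (∑ J ∈ σ.powerset, (-1:ℝ)^J.card * (if ∀ i ∈ J, ∀ j ∈ σ, ¬ R i j then 1 else 0) - 1) := by
      rw [← Finset.sum_filter, Finset.filter_filter]
      have : σ.powerset = insert ∅ (Finset.univ.powerset.filter (fun a : Finset (Fin n) => a.Nonempty ∧ a ⊆ σ)) := by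
        ext J
        by_cases hJ : J = ∅
        · simp [hJ]
        · simp [hJ, Finset.nonempty_iff_ne_empty]
      rw [this, Finset.sum_insert (by simp)]
      simp only [Finset.card_empty, pow_zero, Finset.notMem_empty, false_imp_iff, implies_true, if_true, mul_one, add_sub_cancel_left]
      rw [Finset.mul_sum]
      refine Finset.sum_congr rfl fun J _ => ?_
      rw [pow_add, mul_assoc]
    rw [h3, h]
    obtain ⟨m, hm⟩ : ∃ m, σ.card = m + 1 := ⟨σ.card - 1, by have := hne.card_pos; omega⟩
    split_ifs <;> simp [hm, pow_succ]
  rw [Finset.sum_congr rfl h1, Finset.sum_comm]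
  refine Finset.sum_congr rfl fun J hJ => ?_
  have hne : J.Nonempty := by simpa using hJ
  rw [← Finset.sum_filter, Finset.filter_filter]
  have h := comb_aux (Jᶜ) (fun l => ∀ i ∈ J, ¬ R i l)
  have h4 : ∑ σ ∈ Finset.univ.powerset.filter (fun a : Finset (Fin n) => a.Nonempty ∧ J ⊆ a),
      ((-1:ℝ)^(σ.card + J.card) * (if ∀ i ∈ J, ∀ j ∈ σ, ¬ R i j then 1 else 0))
      = ∑ τ ∈ Jᶜ.powerset, (if (∀ i ∈ J, ∀ j ∈ J, ¬ R i j) then 1 else 0) *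
        ((-1:ℝ)^τ.card * (if ∀ l ∈ τ, ∀ i ∈ J, ¬ R i l then 1 else 0)) := by
    refine Finset.sum_bij' (fun σ _ => σ \ J) (fun τ _ => J ∪ τ) ?_ ?_ ?_ ?_ ?_
    · intro σ hσ
      simp only [Finset.mem_powerset]
      intro a; simp
    · intro τ hτ
      simp [hne]
    · intro σ hσ
      simp at hσ
      simp [hσ.2]
    · intro τ hτ
      simp only [Finset.mem_powerset] at hτ
      rw [Finset.union_sdiff_left]
      refine Finset.sdiff_eq_self_of_disjoint ?_
      exact Finset.disjoint_left.2 fun a ha hb => by have := hτ ha; simp at this; exact this hb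
    · intro σ hσ
      simp at hσ
      have hc : σ.card = (σ \ J).card + J.card := (Finset.card_sdiff_add_card_eq_card hσ.2).symm
      have e : (∀ i ∈ J, ∀ j ∈ σ, ¬ R i j) ↔ (∀ i ∈ J, ∀ j ∈ J, ¬ R i j) ∧ (∀ l ∈ σ \ J, ∀ i ∈ J, ¬ R i l) := by
        constructor
        · intro H
          exact ⟨fun i hi j hj => H i hi j (hσ.2 hj), fun l hl i hi => H i hi l (Finset.mem_sdiff.1 hl).1⟩
        · rintro ⟨H1, H2⟩ i hi j hj
          by_cases hjJ : j ∈ J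
          · exact H1 i hi j hjJ
          · exact H2 j (Finset.mem_sdiff.2 ⟨hj, hjJ⟩) i hi
      have e2 : (-1:ℝ)^(σ.card + J.card) = (-1)^(σ \ J).card := by
        rw [hc, add_assoc, pow_add, ← two_mul, pow_mul (-1:ℝ) 2]; simp
      rw [e2]
      by_cases H1 : ∀ i ∈ J, ∀ j ∈ J, ¬ R i j
      · rw [if_pos H1, one_mul]
        by_cases H2 : ∀ l ∈ σ \ J, ∀ i ∈ J, ¬ R i l
        · rw [if_pos H2, if_pos (e.2 ⟨H1, H2⟩)]
        · rw [if_neg H2, if_neg (fun h => H2 (e.1 h).2)]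
      · rw [if_neg H1, if_neg (fun h => H1 (e.1 h).1)]; simp
  rw [h4, ← Finset.mul_sum, h]
  have e : (∃ i ∈ Jᶜ, ∀ i_1 ∈ J, ¬ R i_1 i) ↔ ¬ (∀ l, l ∉ J → ∃ i ∈ J, R i l) := by
    push Not; simp
  by_cases H1 : ∀ i ∈ J, ∀ j ∈ J, ¬ R i j <;> by_cases H2 : (∀ l, l ∉ J → ∃ i ∈ J, R i l)
  · rw [if_pos H1, if_neg (by rw [e]; simpa using H2), if_pos ⟨H1, H2⟩, mul_one]
  · rw [if_pos H1, if_pos (by rw [e]; exact H2), if_neg (fun h => H2 h.2), mul_zero]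
  · rw [if_neg H1, zero_mul, if_neg (fun h => H1 h.1)]
  · rw [if_neg H1, zero_mul, if_neg (fun h => H1 h.1)]

lemma meas_sep (m : ℕ) (r L : ℝ) : MeasurableSet {y : Fin m → ℝ | (∀ i, 0 ≤ y i ∧ y i ≤ L) ∧ ∀ i j, i ≠ j → r ≤ |y i - y j|} := by
  have : {y : Fin m → ℝ | (∀ i, 0 ≤ y i ∧ y i ≤ L) ∧ ∀ i j, i ≠ j → r ≤ |y i - y j|}
     = (⋂ i, {y | 0 ≤ y i} ∩ {y | y i ≤ L}) ∩ ⋂ i, ⋂ j, ⋂ (_ : i ≠ j), {y | r ≤ |y i - y j|} := by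
    ext y; simp
  rw [this]
  refine MeasurableSet.inter (MeasurableSet.iInter fun i => MeasurableSet.inter ?_ ?_) 
    (MeasurableSet.iInter fun i => MeasurableSet.iInter fun j => MeasurableSet.iInter fun _ => ?_)
  · exact measurableSet_le (by fun_prop) (by fun_prop)
  · exact measurableSet_le (by fun_prop) (by fun_prop)
  · exact measurableSet_le (by fun_prop) (by fun_prop)

lemma int_aux (m : ℕ) (c L : ℝ) (hc : 0 ≤ c) (hm : m = 0 → c = 0) :
    ∫⁻ t in Set.Icc 0 L, ENNReal.ofReal ((max (t - c) 0) ^ m)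
      = ENNReal.ofReal ((max (L - c) 0) ^ (m+1) / (m+1)) := by
  have h0 : ∀ t ∈ Set.Icc 0 L \ Set.Ioc c L, t ≠ 0 → (max (t - c) 0) ^ m = 0 := by
    rintro t ⟨⟨h1, h2⟩, h3⟩ ht
    have : t ≤ c := by by_contra h; exact h3 ⟨not_le.1 h, h2⟩
    rw [max_eq_right (by linarith)]
    refine zero_pow fun h => ?_
    have := hm h
    exact ht (by linarith)
  have h1 : ∫⁻ t in Set.Icc 0 L, ENNReal.ofReal ((max (t - c) 0) ^ m)
     = ∫⁻ t in Set.Ioc c L, ENNReal.ofReal ((t - c) ^ m) := by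
    rw [← lintegral_indicator measurableSet_Icc, ← lintegral_indicator measurableSet_Ioc]
    refine lintegral_congr_ae ?_
    have : ∀ᵐ t : ℝ, t ≠ 0 := by simp [ae_iff]
    filter_upwards [this] with t ht
    by_cases h : t ∈ Set.Ioc c L
    · have h' : t ∈ Set.Icc 0 L := ⟨by linarith [h.1], h.2⟩
      rw [Set.indicator_of_mem h, Set.indicator_of_mem h', max_eq_left (by linarith [h.1])]
    · rw [Set.indicator_of_notMem h]
      by_cases h' : t ∈ Set.Icc 0 L
      · rw [Set.indicator_of_mem h', h0 t ⟨h', h⟩ ht, ENNReal.ofReal_zero]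
      · rw [Set.indicator_of_notMem h']
  rw [h1]
  by_cases hL : c ≤ L
  · rw [← ofReal_integral_eq_lintegral_ofReal, ← intervalIntegral.integral_of_le hL]
    · congr 1
      rw [intervalIntegral.integral_comp_sub_right (fun x => x ^ m) c, integral_pow, max_eq_left (by linarith)]
      simp
    · refine IntegrableOn.integrable ?_
      exact (Continuous.integrableOn_Icc (by fun_prop)).mono_set Set.Ioc_subset_Icc_self
    · refine (ae_restrict_iff' measurableSet_Ioc).2 (Filter.Eventually.of_forall fun t ht => ?_)
      exact pow_nonneg (by linarith [ht.1]) _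
  · rw [Set.Ioc_eq_empty (by linarith), max_eq_right (by linarith)]
    simp

lemma vol_sep (r : ℝ) (hr : 0 < r) (m : ℕ) : ∀ L : ℝ,
    volume {y : Fin m → ℝ | (∀ i, 0 ≤ y i ∧ y i ≤ L) ∧ ∀ i j, i ≠ j → r ≤ |y i - y j|}
      = ENNReal.ofReal ((max (L - (m - 1) * r) 0) ^ m) := by
  induction m with
  | zero => 
    intro L
    have : {y : Fin 0 → ℝ | (∀ i, 0 ≤ y i ∧ y i ≤ L) ∧ ∀ i j, i ≠ j → r ≤ |y i - y j|} = Set.univ := by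
      ext y; simp
    rw [this]; simp [volume_pi]
  | succ m ih =>
    intro L
    let S : Set (ℝ × (Fin m → ℝ)) := {p | (0 ≤ p.1 ∧ p.1 ≤ L) ∧ (∀ i, 0 ≤ p.2 i ∧ p.2 i ≤ p.1 - r) ∧
      ∀ i j, i ≠ j → r ≤ |p.2 i - p.2 j|}
    have hS : MeasurableSet S := by
      have : S = ({p | 0 ≤ p.1} ∩ {p | p.1 ≤ L}) ∩ ((⋂ i, {p | 0 ≤ p.2 i} ∩ {p | p.2 i ≤ p.1 - r}) ∩ ⋂ i, ⋂ j, ⋂ (_ : i ≠ j), {p | r ≤ |p.2 i - p.2 j|}) := by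
        ext y; simp [S]
      rw [this]
      refine MeasurableSet.inter (MeasurableSet.inter ?_ ?_) <| MeasurableSet.inter (MeasurableSet.iInter fun i => MeasurableSet.inter ?_ ?_) 
        (MeasurableSet.iInter fun i => MeasurableSet.iInter fun j => MeasurableSet.iInter fun _ => ?_)
      all_goals exact measurableSet_le (by fun_prop) (by fun_prop)
    have hun : {y : Fin (m+1) → ℝ | (∀ i, 0 ≤ y i ∧ y i ≤ L) ∧ ∀ i j, i ≠ j → r ≤ |y i - y j|}
        = ⋃ i ∈ (Finset.univ : Finset (Fin (m+1))), (MeasurableEquiv.piFinSuccAbove (fun _ => ℝ) i) ⁻¹' S := by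
      ext y
      simp only [Set.mem_ofPred_eq, Finset.mem_univ, Set.iUnion_true, Set.mem_iUnion, Set.mem_preimage, S]
      have key : ∀ i, (MeasurableEquiv.piFinSuccAbove (fun _ => ℝ) i) y = (y i, fun j => y (i.succAbove j)) := fun i => rfl
      simp only [key]
      constructor
      · rintro ⟨h1, h2⟩
        obtain ⟨i, -, hi⟩ := Finset.exists_max_image Finset.univ y Finset.univ_nonempty
        refine ⟨i, h1 i, fun j => ⟨(h1 _).1, ?_⟩, fun j k hjk => h2 _ _ (fun h => hjk (Fin.succAbove_right_injective h))⟩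
        have := h2 i (i.succAbove j) (Fin.succAbove_ne i j).symm
        have h3 := hi (i.succAbove j) (Finset.mem_univ _)
        rw [abs_of_nonneg (by linarith)] at this
        linarith
      · rintro ⟨i, h1, h2, h3⟩
        have hd : ∀ j, j ≠ i → 0 ≤ y j ∧ y j ≤ y i - r := by
          intro j hj
          obtain ⟨k, rfl⟩ := Fin.exists_succAbove_eq hj
          exact h2 k
        refine ⟨fun j => ?_, fun j k hjk => ?_⟩
        · by_cases hj : j = i
          · subst hj; exact h1
          · have := hd j hj; exact ⟨this.1, by linarith [h1.2]⟩
        · by_cases hj : j = i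
          · subst hj
            have := hd k hjk.symm
            rw [abs_of_nonneg (by linarith)]; linarith
          · by_cases hk : k = i
            · subst hk
              have := hd j hjk
              rw [abs_of_nonpos (by linarith)]; linarith
            · obtain ⟨j, rfl⟩ := Fin.exists_succAbove_eq hj
              obtain ⟨k, rfl⟩ := Fin.exists_succAbove_eq hk
              exact h3 j k (fun h => hjk (by rw [h]))
    rw [hun, measure_biUnion_finset]
    · have hv : ∀ i : Fin (m+1), volume ((MeasurableEquiv.piFinSuccAbove (fun _ => ℝ) i) ⁻¹' S) = 
          ENNReal.ofReal ((max (L - m * r) 0) ^ (m+1) / (m+1)) := by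
        intro i
        rw [(volume_preserving_piFinSuccAbove (fun _ => ℝ) i).measure_preimage hS.nullMeasurableSet,
          Measure.volume_eq_prod, Measure.prod_apply hS]
        rw [← int_aux m (m * r) L (by positivity) (by rintro rfl; simp), ← lintegral_indicator measurableSet_Icc]
        refine lintegral_congr fun t => ?_
        by_cases ht : t ∈ Set.Icc 0 L
        · rw [Set.indicator_of_mem ht]
          have : Prod.mk t ⁻¹' S = {y : Fin m → ℝ | (∀ i, 0 ≤ y i ∧ y i ≤ t - r) ∧ ∀ i j, i ≠ j → r ≤ |y i - y j|} := by
            ext y; simp [S, ht.1, ht.2]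
          rw [this, ih]
          congr 3; ring
        · rw [Set.indicator_of_notMem ht]
          have : Prod.mk t ⁻¹' S = ∅ := by
            ext y
            simp only [S, Set.mem_preimage, Set.mem_ofPred_eq, Set.mem_empty_iff_false, iff_false]
            exact fun h => ht h.1
          rw [this, measure_empty]
      rw [Finset.sum_congr rfl fun i _ => hv i, Finset.sum_const, nsmul_eq_mul, Finset.card_univ, Fintype.card_fin,
        ← ENNReal.ofReal_natCast, ← ENNReal.ofReal_mul (by positivity)]
      congr 1
      push_cast
      field_simp
      congr 2; ring
    · intro i _ j _ hij
      refine Set.disjoint_left.2 fun y hy hy' => ?_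
      obtain ⟨k, hk⟩ := Fin.exists_succAbove_eq hij
      obtain ⟨k', hk'⟩ := Fin.exists_succAbove_eq hij.symm
      have h1 : y (i.succAbove k') ≤ y i - r := (hy.2.1 k').2
      have h2 : y (j.succAbove k) ≤ y j - r := (hy'.2.1 k).2
      rw [hk'] at h1
      rw [hk] at h2
      linarith
    · intro i _
      exact (MeasurableEquiv.measurable _) hS

/-- clockwise distance in `(0,1]` -/
noncomputable def cw (a b : AddCircle (1:ℝ)) : ℝ := (AddCircle.equivIoc (1:ℝ) 0 (b - a) : ℝ)

lemma cw_pos (a b : AddCircle (1:ℝ)) : 0 < cw a b := (AddCircle.equivIoc (1:ℝ) 0 (b - a)).2.1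

lemma cw_le (a b : AddCircle (1:ℝ)) : cw a b ≤ 1 := by
  have := (AddCircle.equivIoc (1:ℝ) 0 (b - a)).2.2
  simpa [cw] using this

lemma coe_cw (a b : AddCircle (1:ℝ)) : ((cw a b : ℝ) : AddCircle (1:ℝ)) = b - a :=
  AddCircle.coe_equivIoc

lemma cw_eq (a b : AddCircle (1:ℝ)) (t : ℝ) (h0 : 0 < t) (h1 : t ≤ 1)
    (h : (t : AddCircle (1:ℝ)) = b - a) : cw a b = t := by
  unfold cw
  rw [← h]
  exact AddCircle.equivIoc_coe_of_mem (by simpa using ⟨h0, h1⟩)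

lemma coe_one' : ((1:ℝ) : AddCircle (1:ℝ)) = 0 := AddCircle.coe_period 1

lemma cw_self (a : AddCircle (1:ℝ)) : cw a a = 1 :=
  cw_eq a a 1 one_pos le_rfl (by rw [coe_one', sub_self])

lemma cw_symm (a b : AddCircle (1:ℝ)) (h : cw a b ≠ 1) : cw b a = 1 - cw a b := by
  have h1 : cw a b < 1 := lt_of_le_of_ne (cw_le a b) h
  refine cw_eq _ _ _ (by linarith) (by linarith [cw_pos a b]) ?_
  rw [AddCircle.coe_sub, coe_one', coe_cw]; abel

lemma cw_symm_one (a b : AddCircle (1:ℝ)) (h : cw a b = 1) : cw b a = 1 := by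
  have := coe_cw a b
  rw [h, coe_one'] at this
  rw [sub_eq_zero.1 this.symm, cw_self]

lemma norm_coe_le (t : ℝ) : ‖(t : AddCircle (1:ℝ))‖ ≤ |t| := by
  have := AddCircle.norm_eq (1:ℝ) (x := t)
  rw [this]
  simpa using round_le t 0

lemma norm_circ (t : ℝ) (h0 : 0 ≤ t) (h1 : t ≤ 1) : ‖(t : AddCircle (1:ℝ))‖ = min t (1 - t) := by
  by_cases h : t ≤ 1/2
  · rw [(AddCircle.norm_coe_eq_abs_iff (1:ℝ) one_ne_zero).2 (by rw [abs_of_nonneg h0]; simpa using h),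
      abs_of_nonneg h0, min_eq_left (by linarith)]
  · have : ((t:ℝ) : AddCircle (1:ℝ)) = ((t - 1 : ℝ) : AddCircle (1:ℝ)) := by
      rw [AddCircle.coe_sub, coe_one', sub_zero]
    have e : |t - 1| = 1 - t := by rw [abs_of_nonpos (by linarith)]; ring
    rw [this, (AddCircle.norm_coe_eq_abs_iff (1:ℝ) one_ne_zero).2 (by rw [e, abs_one]; linarith),
      e, min_eq_right (by linarith)]

lemma dist_cw (a b : AddCircle (1:ℝ)) : dist a b = min (cw a b) (1 - cw a b) := by
  rw [dist_comm, dist_eq_norm, ← coe_cw, norm_circ _ (cw_pos a b).le (cw_le a b)]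

lemma measurable_cw : Measurable (fun p : AddCircle (1:ℝ) × AddCircle (1:ℝ) => cw p.1 p.2) := by
  have : Measurable (fun u : AddCircle (1:ℝ) => (AddCircle.equivIoc (1:ℝ) 0 u : ℝ)) :=
    measurable_subtype_coe.comp (AddCircle.measurableEquivIoc (1:ℝ) 0).measurable
  exact this.comp (by fun_prop)

/-- `b` lies in the clockwise arc of length `r` after `a`, ties broken by index. -/
def Bad (r : ℝ) {n : ℕ} (i j : Fin n) (a b : AddCircle (1:ℝ)) : Prop :=
  cw a b < r ∨ (cw a b = 1 ∧ i < j)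

lemma exists_rep (c a : AddCircle (1:ℝ)) : ∃ d : ℝ, (d : AddCircle (1:ℝ)) = a - c ∧ |d| = dist c a := by
  by_cases h : cw c a ≤ 1/2
  · refine ⟨cw c a, coe_cw c a, ?_⟩
    rw [dist_cw, abs_of_pos (cw_pos _ _), min_eq_left (by linarith)]
  · refine ⟨cw c a - 1, ?_, ?_⟩
    · rw [AddCircle.coe_sub, coe_one', coe_cw, sub_zero]
    · rw [dist_cw, min_eq_right (by linarith), abs_of_nonpos (by linarith [cw_le c a])]; ring

lemma nerve_iff {n : ℕ} (r : ℝ) (hr0 : 0 < r) (hr1 : r < 1) (x : Fin n → AddCircle (1:ℝ))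
    (σ : Finset (Fin n)) (hσ : σ.Nonempty) :
    (∃ c : AddCircle (1:ℝ), ∀ i ∈ σ, dist c (x i) ≤ (1 - r) / 2) ↔
      ∃ i ∈ σ, ∀ j ∈ σ, ¬ Bad r i j (x i) (x j) := by
  constructor
  · rintro ⟨c, hc⟩
    choose d hd1 hd2 using fun i => exists_rep c (x i)
    obtain ⟨i, hi, hmax⟩ := Finset.exists_max_image σ (fun i => toLex (d i, i)) hσ
    refine ⟨i, hi, fun j hj => ?_⟩
    have h := hmax j hj
    rw [Prod.Lex.toLex_le_toLex] at h
    have hdi : |d i| ≤ (1 - r)/2 := (hd2 i).trans_le (hc i hi)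
    have hdj : |d j| ≤ (1 - r)/2 := (hd2 j).trans_le (hc j hj)
    rw [abs_le] at hdi hdj
    have hcoe : ((d j - d i : ℝ) : AddCircle (1:ℝ)) = x j - x i := by
      rw [AddCircle.coe_sub, hd1, hd1]; abel
    rcases h with h | ⟨h, h'⟩
    · have e : cw (x i) (x j) = 1 + (d j - d i) := by
        refine cw_eq _ _ _ (by linarith) (by simp only at h; linarith) ?_
        rw [AddCircle.coe_add, coe_one', hcoe, zero_add]
      simp only at h
      rintro (hb | ⟨hb, -⟩) <;> rw [e] at hb <;> linarith
    · simp only at h h'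
      have e : cw (x i) (x j) = 1 := by
        refine cw_eq _ _ _ (by linarith) le_rfl ?_
        rw [coe_one', ← hcoe, h, sub_self, AddCircle.coe_zero]
      rintro (hb | ⟨-, hb⟩)
      · linarith
      · exact absurd hb (not_lt.2 h')
  · rintro ⟨i, hi, h⟩
    refine ⟨x i + ((r/2 + 1/2 : ℝ) : AddCircle (1:ℝ)), fun j hj => ?_⟩
    have hg : r ≤ cw (x i) (x j) := by
      by_contra hh
      exact h j hj (Or.inl (not_le.1 hh))
    have e : x i + ((r/2 + 1/2 : ℝ) : AddCircle (1:ℝ)) - x j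
        = ((r/2 + 1/2 - cw (x i) (x j) : ℝ) : AddCircle (1:ℝ)) := by
      rw [AddCircle.coe_sub, coe_cw]; abel
    rw [dist_eq_norm, e]
    refine (norm_coe_le _).trans ?_
    rw [abs_le]
    constructor <;> linarith [cw_le (x i) (x j)]

lemma measurableSet_bad (r : ℝ) {n : ℕ} (i j : Fin n) :
    MeasurableSet {p : AddCircle (1:ℝ) × AddCircle (1:ℝ) | Bad r i j p.1 p.2} := by
  have : {p : AddCircle (1:ℝ) × AddCircle (1:ℝ) | Bad r i j p.1 p.2}
     = {p | cw p.1 p.2 < r} ∪ ({p | cw p.1 p.2 = 1} ∩ {p | i < j}) := rfl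
  rw [this]
  refine (measurableSet_lt measurable_cw measurable_const).union (MeasurableSet.inter ?_ (MeasurableSet.const _))
  exact measurable_cw (measurableSet_singleton 1)

lemma measurableSet_bad' {X : Type*} [MeasurableSpace X] (r : ℝ) {n : ℕ} (i j : Fin n)
    {f g : X → AddCircle (1:ℝ)} (hf : Measurable f) (hg : Measurable g) :
    MeasurableSet {x | Bad r i j (f x) (g x)} :=
  (hf.prodMk hg) (measurableSet_bad r i j)

lemma vol_bad (r : ℝ) (hr0 : 0 < r) (hr1 : r < 1) {n : ℕ} (i j : Fin n) (a : AddCircle (1:ℝ)) :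
    volume {b : AddCircle (1:ℝ) | Bad r i j a b} = ENNReal.ofReal r := by
  have hm : ∀ c : AddCircle (1:ℝ), MeasurableSet {b : AddCircle (1:ℝ) | Bad r i j c b} :=
    fun c => measurableSet_bad' r i j measurable_const measurable_id
  have h1 : {b : AddCircle (1:ℝ) | Bad r i j a b} = (fun h => -a + h) ⁻¹' {b | Bad r i j 0 b} := by
    ext b
    have : cw a b = cw 0 (-a + b) := by unfold cw; congr 2; abel
    simp [Bad, this]
  rw [h1, measure_preimage_add]
  have hp := AddCircle.measurePreserving_mk (1:ℝ) 0
  rw [← hp.measure_preimage (hm 0).nullMeasurableSet, Measure.restrict_apply (hp.measurable (hm 0))]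
  have hcw : ∀ t ∈ Set.Ioc (0:ℝ) (0+1), cw 0 (t : AddCircle (1:ℝ)) = t := by
    intro t ht
    exact cw_eq _ _ _ ht.1 (by simpa using ht.2) (by simp)
  apply le_antisymm
  · calc _ ≤ volume (Set.Ioo 0 r ∪ {1}) := by
          refine measure_mono ?_
          rintro t ⟨h, ht⟩
          rcases h with h | ⟨h, -⟩
          · rw [show (QuotientAddGroup.mk t : AddCircle (1:ℝ)) = (t : AddCircle (1:ℝ)) from rfl, hcw t ht] at h
            exact Or.inl ⟨ht.1, h⟩
          · rw [show (QuotientAddGroup.mk t : AddCircle (1:ℝ)) = (t : AddCircle (1:ℝ)) from rfl, hcw t ht] at h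
            exact Or.inr h
      _ ≤ _ := (measure_union_le _ _).trans (by simp)
  · calc ENNReal.ofReal r = volume (Set.Ioo 0 r) := by simp
      _ ≤ _ := by
          refine measure_mono ?_
          intro t ht
          have ht' : t ∈ Set.Ioc (0:ℝ) (0+1) := ⟨ht.1, by linarith [ht.2]⟩
          refine ⟨?_, ht'⟩
          left
          rw [show (QuotientAddGroup.mk t : AddCircle (1:ℝ)) = (t : AddCircle (1:ℝ)) from rfl, hcw t ht']
          exact ht.2

lemma not_bad_iff (r : ℝ) (hr0 : 0 < r) (hr1 : r < 1) {n : ℕ} (i j : Fin n) (hij : i ≠ j) (a b : AddCircle (1:ℝ)) :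
    (¬ Bad r i j a b ∧ ¬ Bad r j i b a) ↔ r ≤ dist a b := by
  rw [dist_cw, le_min_iff]
  unfold Bad
  by_cases h : cw a b = 1
  · have h' := cw_symm_one a b h
    rw [h, h']
    rcases lt_or_gt_of_ne hij with h2 | h2
    · simp only [h2]; simp [hr0]
    · simp only [h2]; simp [hr0]
  · have h' := cw_symm a b h
    rw [h']
    have h3 : 1 - cw a b ≠ 1 := by have := cw_pos a b; intro h; linarith
    simp only [h, h3, false_and, or_false, not_lt]

lemma bad_disj (r : ℝ) (hr1 : r < 1) {n : ℕ} (i j l : Fin n) (a b c : AddCircle (1:ℝ))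
    (hab : r ≤ dist a b) (hr0 : 0 < r) (h1 : Bad r i l a c) (h2 : Bad r j l b c) : False := by
  rw [dist_cw, le_min_iff] at hab
  -- reduce ties to `c = a` or `c = b`
  have tie : ∀ u v : AddCircle (1:ℝ), cw u v = 1 → v = u := by
    intro u v h
    have := coe_cw u v
    rw [h, coe_one'] at this
    exact sub_eq_zero.1 this.symm
  have hne : cw a b ≠ 1 := by intro h; linarith
  have hs := cw_symm a b hne
  rcases h1 with h1 | ⟨h1, -⟩
  · rcases h2 with h2 | ⟨h2, -⟩
    · have e : ((cw a c - cw b c : ℝ) : AddCircle (1:ℝ)) = b - a := by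
        rw [AddCircle.coe_sub, coe_cw, coe_cw]; abel
      have p1 := cw_pos a c
      have p2 := cw_pos b c
      rcases lt_trichotomy (cw a c) (cw b c) with h | h | h
      · have := cw_eq a b (1 + (cw a c - cw b c)) (by linarith) (by linarith)
          (by rw [AddCircle.coe_add, coe_one', e, zero_add])
        linarith
      · exact hne (cw_eq a b 1 one_pos le_rfl (by rw [coe_one', ← e, h, sub_self, AddCircle.coe_zero]))
      · have := cw_eq a b _ (by linarith) (by linarith) e
        linarith
    · have := tie _ _ h2
      subst this
      linarith
  · have := tie _ _ h1
    subst this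
    rcases h2 with h2 | ⟨h2, -⟩
    · linarith
    · linarith

lemma meas_csep {ι : Type*} [Fintype ι] (r : ℝ) :
    MeasurableSet {y : ι → AddCircle (1:ℝ) | ∀ i j, i ≠ j → r ≤ dist (y i) (y j)} := by
  have : {y : ι → AddCircle (1:ℝ) | ∀ i j, i ≠ j → r ≤ dist (y i) (y j)}
      = ⋂ i, ⋂ j, ⋂ (_ : i ≠ j), {y | r ≤ dist (y i) (y j)} := by
    ext y; simp
  rw [this]
  exact (MeasurableSet.iInter fun i => MeasurableSet.iInter fun j => MeasurableSet.iInter fun _ =>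
    measurableSet_le (by fun_prop) (by fun_prop))

lemma vol_csep0 (r : ℝ) (hr : 0 < r) (m : ℕ) :
    volume {y : Fin m → AddCircle (1:ℝ) | (∀ i, r ≤ ‖y i‖) ∧ ∀ i j, i ≠ j → r ≤ dist (y i) (y j)}
      = ENNReal.ofReal ((max (1 - (m + 1) * r) 0) ^ m) := by
  have hm : MeasurableSet {y : Fin m → AddCircle (1:ℝ) | (∀ i, r ≤ ‖y i‖) ∧ ∀ i j, i ≠ j → r ≤ dist (y i) (y j)} := by
    have : {y : Fin m → AddCircle (1:ℝ) | (∀ i, r ≤ ‖y i‖) ∧ ∀ i j, i ≠ j → r ≤ dist (y i) (y j)}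
        = (⋂ i, {y | r ≤ ‖y i‖}) ∩ {y | ∀ i j, i ≠ j → r ≤ dist (y i) (y j)} := by
      ext y; simp
    rw [this]
    exact (MeasurableSet.iInter fun i => measurableSet_le (by fun_prop) (by fun_prop)).inter (meas_csep r)
  have hp := measurePreserving_pi (fun _ : Fin m => (volume : Measure ℝ).restrict (Set.Ioc 0 (0+1)))
    (fun _ : Fin m => (volume : Measure (AddCircle (1:ℝ)))) (fun _ => AddCircle.measurePreserving_mk (1:ℝ) 0)
  rw [volume_pi, ← hp.measure_preimage hm.nullMeasurableSet, ← Measure.restrict_pi_pi,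
    Measure.restrict_apply (hp.measurable hm)]
  have e : (fun (a : Fin m → ℝ) i => (QuotientAddGroup.mk (a i) : AddCircle (1:ℝ))) ⁻¹'
      {y : Fin m → AddCircle (1:ℝ) | (∀ i, r ≤ ‖y i‖) ∧ ∀ i j, i ≠ j → r ≤ dist (y i) (y j)} ∩
      (Set.univ.pi fun _ => Set.Ioc 0 (0+1))
      = (fun h => (fun _ => -r) + h) ⁻¹'
       {y : Fin m → ℝ | (∀ i, 0 ≤ y i ∧ y i ≤ 1 - 2 * r) ∧ ∀ i j, i ≠ j → r ≤ |y i - y j|} := by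
    ext y
    have key : ∀ i, (r ≤ ‖(y i : AddCircle (1:ℝ))‖ ∧ 0 < y i ∧ y i ≤ 1) ↔ r ≤ y i ∧ y i ≤ 1 - r := by
      intro i
      constructor
      · rintro ⟨h, h0, h1⟩
        rw [norm_circ _ h0.le h1, le_min_iff] at h
        exact ⟨h.1, by linarith⟩
      · rintro ⟨h1, h2⟩
        rw [norm_circ _ (by linarith) (by linarith), le_min_iff]
        refine ⟨⟨h1, by linarith⟩, by linarith, by linarith⟩
    have key2 : (∀ i, r ≤ y i ∧ y i ≤ 1 - r) → ∀ i j, (r ≤ dist (y i : AddCircle (1:ℝ)) (y j) ↔ r ≤ |y i - y j|) := by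
      intro H
      have aux : ∀ i j, y j ≤ y i → (r ≤ dist (y i : AddCircle (1:ℝ)) (y j) ↔ r ≤ |y i - y j|) := by
        intro i j hij
        have := H i
        have := H j
        rw [dist_eq_norm, ← AddCircle.coe_sub, norm_circ _ (by linarith) (by linarith), le_min_iff,
          abs_of_nonneg (by linarith)]
        exact ⟨fun h => h.1, fun h => ⟨h, by linarith⟩⟩
      intro i j
      rcases le_total (y j) (y i) with h | h
      · exact aux i j h
      · rw [dist_comm, abs_sub_comm]; exact aux j i h
    simp only [Set.mem_inter_iff, Set.mem_preimage, Set.mem_ofPred_eq, Set.mem_univ_pi, Set.mem_Ioc, zero_add, Pi.add_apply]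
    constructor
    · rintro ⟨⟨h1, h2⟩, h3⟩
      have H : ∀ i, r ≤ y i ∧ y i ≤ 1 - r := fun i => (key i).1 ⟨h1 i, h3 i⟩
      refine ⟨fun i => ⟨by linarith [(H i).1], by linarith [(H i).2]⟩, fun i j hij => ?_⟩
      rw [add_sub_add_left_eq_sub]
      exact (key2 H i j).1 (h2 i j hij)
    · rintro ⟨h1, h2⟩
      have H : ∀ i, r ≤ y i ∧ y i ≤ 1 - r := fun i => ⟨by linarith [(h1 i).1], by linarith [(h1 i).2]⟩
      refine ⟨⟨fun i => ((key i).2 (H i)).1, fun i j hij => (key2 H i j).2 ?_⟩, fun i => ((key i).2 (H i)).2⟩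
      have := h2 i j hij
      rwa [add_sub_add_left_eq_sub] at this
  have hv := vol_sep r hr m (1 - 2 * r)
  rw [e, ← volume_pi, measure_preimage_add, hv]
  congr 3; ring

lemma vol_csep1 (r : ℝ) (hr : 0 < r) (m : ℕ) :
    volume {y : Fin (m+1) → AddCircle (1:ℝ) | ∀ i j, i ≠ j → r ≤ dist (y i) (y j)}
      = ENNReal.ofReal ((max (1 - (m + 1) * r) 0) ^ m) := by
  have hp := (volume_preserving_piFinSuccAbove (fun _ : Fin (m+1) => AddCircle (1:ℝ)) 0).symm
  have hm := meas_csep (ι := Fin (m+1)) r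
  rw [← hp.measure_preimage hm.nullMeasurableSet, Measure.volume_eq_prod,
    Measure.prod_apply (hp.measurable hm)]
  have : ∀ a : AddCircle (1:ℝ), volume (Prod.mk a ⁻¹' ((MeasurableEquiv.piFinSuccAbove (fun _ : Fin (m+1) => AddCircle (1:ℝ)) 0).symm ⁻¹'
      {y : Fin (m+1) → AddCircle (1:ℝ) | ∀ i j, i ≠ j → r ≤ dist (y i) (y j)}))
      = ENNReal.ofReal ((max (1 - (m + 1) * r) 0) ^ m) := by
    intro a
    rw [← vol_csep0 r hr m]
    have e : Prod.mk a ⁻¹' ((MeasurableEquiv.piFinSuccAbove (fun _ : Fin (m+1) => AddCircle (1:ℝ)) 0).symm ⁻¹'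
      {y : Fin (m+1) → AddCircle (1:ℝ) | ∀ i j, i ≠ j → r ≤ dist (y i) (y j)})
      = (fun h => (fun _ => -a) + h) ⁻¹' {y : Fin m → AddCircle (1:ℝ) | (∀ i, r ≤ ‖y i‖) ∧ ∀ i j, i ≠ j → r ≤ dist (y i) (y j)} := by
      ext y
      have k : (MeasurableEquiv.piFinSuccAbove (fun _ : Fin (m+1) => AddCircle (1:ℝ)) 0).symm (a, y) = Fin.cons a y := by
        simp [MeasurableEquiv.piFinSuccAbove, Fin.insertNthEquiv]
      have n1 : ∀ i, ‖-a + y i‖ = dist a (y i) := by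
        intro i; rw [dist_comm, dist_eq_norm]; congr 1; abel
      simp only [Set.mem_preimage, k, Set.mem_ofPred_eq, Pi.add_apply, n1, dist_add_left]
      constructor
      · intro h
        refine ⟨fun i => ?_, fun i j hij => ?_⟩
        · simpa using h 0 i.succ (Fin.succ_ne_zero i).symm
        · simpa using h i.succ j.succ (by simpa using hij)
      · rintro ⟨h1, h2⟩ i j hij
        induction i using Fin.cases with
        | zero =>
          induction j using Fin.cases with
          | zero => exact absurd rfl hij
          | succ j => simpa using h1 j
        | succ i =>
          induction j using Fin.cases with
          | zero => rw [dist_comm]; simpa using h1 i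
          | succ j => simpa using h2 i j (by simpa using hij)
    rw [e, measure_preimage_add]
  simp only [this, lintegral_const]
  rw [AddCircle.measure_univ]; simp

lemma vol_csep {ι : Type*} [Fintype ι] (r : ℝ) (hr : 0 < r) (k : ℕ) (hk : 1 ≤ k) (hc : Fintype.card ι = k) :
    volume {y : ι → AddCircle (1:ℝ) | ∀ i j, i ≠ j → r ≤ dist (y i) (y j)}
      = ENNReal.ofReal ((max (1 - k * r) 0) ^ (k - 1)) := by
  obtain ⟨m, rfl⟩ : ∃ m, k = m + 1 := ⟨k - 1, by omega⟩
  let f : Fin (m+1) ≃ ι := (Fintype.equivFinOfCardEq hc).symm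
  have hp := volume_measurePreserving_piCongrLeft (fun _ : ι => AddCircle (1:ℝ)) f
  have hm := meas_csep (ι := ι) r
  have h1 := vol_csep1 r hr m
  push_cast
  rw [← h1, ← hp.measure_preimage hm.nullMeasurableSet]
  congr 1
  ext y
  have k : ∀ i, MeasurableEquiv.piCongrLeft (fun _ : ι => AddCircle (1:ℝ)) f y (f i) = y i := by
    intro i
    exact Equiv.piCongrLeft_apply_apply (fun _ : ι => AddCircle (1:ℝ)) f y i
  simp only [Set.mem_preimage, Set.mem_ofPred_eq]
  constructor
  · intro h i j hij
    have := h (f i) (f j) (by simpa using hij)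
    rwa [k, k] at this
  · intro h i j hij
    obtain ⟨i, rfl⟩ := f.surjective i
    obtain ⟨j, rfl⟩ := f.surjective j
    rw [k, k]
    exact h i j (fun h => hij (by rw [h]))

/-- the event attached to `J` -/
def Ev (r : ℝ) {n : ℕ} (J : Finset (Fin n)) : Set (Fin n → AddCircle (1:ℝ)) :=
  {x | (∀ i ∈ J, ∀ j ∈ J, ¬ Bad r i j (x i) (x j)) ∧ (∀ l, l ∉ J → ∃ i ∈ J, Bad r i l (x i) (x l))}

lemma meas_Ev (r : ℝ) {n : ℕ} (J : Finset (Fin n)) : MeasurableSet (Ev r J) := by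
  have : Ev r J = (⋂ i ∈ J, ⋂ j ∈ J, {x | Bad r i j (x i) (x j)}ᶜ) ∩
      ⋂ l, ⋂ (_ : l ∉ J), ⋃ i ∈ J, {x | Bad r i l (x i) (x l)} := by
    ext x; simp [Ev]
  rw [this]
  have hb : ∀ i j : Fin n, MeasurableSet {x : Fin n → AddCircle (1:ℝ) | Bad r i j (x i) (x j)} := fun i j =>
    measurableSet_bad' r i j (by fun_prop) (by fun_prop)
  refine MeasurableSet.inter ?_ ?_
  · exact J.measurableSet_biInter fun i _ => J.measurableSet_biInter fun j _ => (hb i j).compl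
  · exact MeasurableSet.iInter fun l => MeasurableSet.iInter fun _ => J.measurableSet_biUnion fun i _ => hb i l

lemma bad_irrefl (r : ℝ) (hr1 : r < 1) {n : ℕ} (i : Fin n) (a : AddCircle (1:ℝ)) : ¬ Bad r i i a a := by
  rintro (h | ⟨-, h⟩)
  · rw [cw_self] at h; linarith
  · exact lt_irrefl _ h

lemma vol_Ev (r : ℝ) (hr0 : 0 < r) (hr1 : r < 1) {n : ℕ} (J : Finset (Fin n)) (hJ : J.Nonempty) :
    volume (Ev r J) = ENNReal.ofReal ((max (1 - J.card * r) 0) ^ (J.card - 1) * (J.card * r) ^ (n - J.card)) := by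
  have hp := (volume_preserving_piEquivPiSubtypeProd (fun _ : Fin n => AddCircle (1:ℝ)) (fun i => i ∈ J)).symm
  have hm := meas_Ev r J
  rw [← hp.measure_preimage hm.nullMeasurableSet, Measure.volume_eq_prod,
    Measure.prod_apply (hp.measurable hm)]
  let A : Set ({i // i ∈ J} → AddCircle (1:ℝ)) := {y | ∀ i j, i ≠ j → r ≤ dist (y i) (y j)}
  have hA : MeasurableSet A := meas_csep r
  have hcJ : Fintype.card {i // i ∈ J} = J.card := by simp
  have hcJ' : Fintype.card {i // i ∉ J} = n - J.card := by
    rw [Fintype.card_subtype_compl]; simp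
  have hin : ∀ y : {i // i ∈ J} → AddCircle (1:ℝ), volume (Prod.mk y ⁻¹' ((MeasurableEquiv.piEquivPiSubtypeProd (fun _ : Fin n => AddCircle (1:ℝ)) (fun i => i ∈ J)).symm ⁻¹' Ev r J))
      = A.indicator (fun _ => ENNReal.ofReal ((J.card * r) ^ (n - J.card))) y := by
    intro y
    have mem : ∀ z : {i // i ∉ J} → AddCircle (1:ℝ), z ∈ (Prod.mk y ⁻¹' ((MeasurableEquiv.piEquivPiSubtypeProd (fun _ : Fin n => AddCircle (1:ℝ)) (fun i => i ∈ J)).symm ⁻¹' Ev r J))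
       ↔ y ∈ A ∧ ∀ l : {i // i ∉ J}, ∃ i : {i // i ∈ J}, Bad r i.1 l.1 (y i) (z l) := by
      intro z
      set x := (MeasurableEquiv.piEquivPiSubtypeProd (fun _ : Fin n => AddCircle (1:ℝ)) (fun i => i ∈ J)).symm (y, z) with hx
      have hx1 : ∀ i (h : i ∈ J), x i = y ⟨i, h⟩ := by
        intro i h
        rw [hx]
        simp [MeasurableEquiv.piEquivPiSubtypeProd, Equiv.piEquivPiSubtypeProd, h]
      have hx2 : ∀ i (h : i ∉ J), x i = z ⟨i, h⟩ := by
        intro i h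
        rw [hx]
        simp [MeasurableEquiv.piEquivPiSubtypeProd, Equiv.piEquivPiSubtypeProd, h]
      rw [Set.mem_preimage, Set.mem_preimage, ← hx]
      constructor
      · rintro ⟨h1, h2⟩
        refine ⟨fun i j hij => ?_, fun l => ?_⟩
        · have hij' : i.1 ≠ j.1 := fun h => hij (Subtype.ext h)
          refine (not_bad_iff r hr0 hr1 i.1 j.1 hij' _ _).1 ⟨?_, ?_⟩
          · have := h1 i.1 i.2 j.1 j.2
            rwa [hx1 i.1 i.2, hx1 j.1 j.2] at this
          · have := h1 j.1 j.2 i.1 i.2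
            rwa [hx1 i.1 i.2, hx1 j.1 j.2] at this
        · obtain ⟨i, hi, hb⟩ := h2 l.1 l.2
          rw [hx1 i hi, hx2 l.1 l.2] at hb
          exact ⟨⟨i, hi⟩, hb⟩
      · rintro ⟨h1, h2⟩
        refine ⟨fun i hi j hj => ?_, fun l hl => ?_⟩
        · by_cases hij : i = j
          · subst hij; exact bad_irrefl r hr1 _ _
          · rw [hx1 i hi, hx1 j hj]
            exact ((not_bad_iff r hr0 hr1 i j hij _ _).2 (h1 ⟨i, hi⟩ ⟨j, hj⟩ (by simpa using hij))).1
        · obtain ⟨i, hb⟩ := h2 ⟨l, hl⟩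
          refine ⟨i.1, i.2, ?_⟩
          rw [hx1 i.1 i.2, hx2 l hl]
          exact hb
    by_cases hy : y ∈ A
    · rw [Set.indicator_of_mem hy]
      have e : (Prod.mk y ⁻¹' ((MeasurableEquiv.piEquivPiSubtypeProd (fun _ : Fin n => AddCircle (1:ℝ)) (fun i => i ∈ J)).symm ⁻¹' Ev r J))
          = Set.univ.pi fun l : {i // i ∉ J} => ⋃ i ∈ (Finset.univ : Finset {i // i ∈ J}), {b | Bad r i.1 l.1 (y i) b} := by
        ext z
        rw [mem]
        simp [hy]
      rw [e, volume_pi, Measure.pi_pi]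
      have hl : ∀ l : {i // i ∉ J}, volume (⋃ i ∈ (Finset.univ : Finset {i // i ∈ J}), {b | Bad r i.1 l.1 (y i) b})
          = ENNReal.ofReal (J.card * r) := by
        intro l
        rw [measure_biUnion_finset]
        · simp only [vol_bad r hr0 hr1]
          rw [Finset.sum_const, Finset.card_univ, hcJ, nsmul_eq_mul, ENNReal.ofReal_mul (by positivity), ENNReal.ofReal_natCast]
        · intro i _ j _ hij
          refine Set.disjoint_left.2 fun b hb hb' => ?_
          exact bad_disj r hr1 i.1 j.1 l.1 _ _ _ (hy i j hij) hr0 hb hb'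
        · intro i _
          exact measurableSet_bad' r i.1 l.1 measurable_const measurable_id
      rw [Finset.prod_congr rfl fun l _ => hl l, Finset.prod_const, Finset.card_univ, hcJ', ENNReal.ofReal_pow (by positivity)]
    · rw [Set.indicator_of_notMem hy]
      have e : (Prod.mk y ⁻¹' ((MeasurableEquiv.piEquivPiSubtypeProd (fun _ : Fin n => AddCircle (1:ℝ)) (fun i => i ∈ J)).symm ⁻¹' Ev r J)) = ∅ := by
        ext z
        rw [mem]
        simp [hy]
      rw [e, measure_empty]
  have hvA : volume A = _ := vol_csep r hr0 J.card hJ.card_pos hcJ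
  rw [lintegral_congr hin, lintegral_indicator_const hA]
  trans ENNReal.ofReal ((J.card * r) ^ (n - J.card)) * ENNReal.ofReal ((max (1 - J.card * r) 0) ^ (J.card - 1))
  · congr 1
    convert hvA
  rw [mul_comm,
    ← ENNReal.ofReal_mul (by positivity)]

/-- Theorem A1: for `n` i.i.d. uniform points on the circle of circumference 1 and `r ∈ (0,1)`,
the expected Euler characteristic of the Čech complex at filtration radius `(1-r)/2` equals
`Σ_{k=1}^{⌊1/r⌋} C(n,k) (1-kr)^(k-1) (kr)^(n-k)`. -/
theorem stmt8 (n : ℕ) (hn : 1 ≤ n) (r : ℝ) (hr0 : 0 < r) (hr1 : r < 1) :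
    ∫ x : Fin n → AddCircle (1:ℝ), cechEuler x ((1 - r) / 2)
        ∂(Measure.pi fun _ : Fin n => (volume : Measure (AddCircle (1:ℝ))))
    = ∑ k ∈ Finset.Icc 1 ⌊1 / r⌋₊,
        (n.choose k : ℝ) * (1 - k * r) ^ (k - 1) * (k * r) ^ (n - k) := by
  rw [← volume_pi]
  let F : ℕ → ℝ := fun k => if k = 0 then 0 else (max (1 - k * r) 0) ^ (k - 1) * (k * r) ^ (n - k)
  have h1 : ∀ x : Fin n → AddCircle (1:ℝ), cechEuler x ((1 - r) / 2)
      = ∑ J ∈ Finset.univ.powerset.filter (fun σ : Finset (Fin n) => σ.Nonempty),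
        (Ev r J).indicator (fun _ => (1:ℝ)) x := by
    intro x
    have hc := comb (fun i j => Bad r i j (x i) (x j))
    unfold cechEuler
    refine Eq.trans (Finset.sum_congr rfl fun σ hσ => ?_) (hc.trans (Finset.sum_congr rfl fun J _ => ?_))
    · have hne : σ.Nonempty := by simpa using hσ
      have hi := nerve_iff r hr0 hr1 x σ hne
      by_cases h : ∃ c : AddCircle (1:ℝ), ∀ i ∈ σ, dist c (x i) ≤ (1 - r) / 2
      · rw [if_pos h, if_pos (hi.1 h)]
      · rw [if_neg h, if_neg (fun h' => h (hi.2 h'))]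
    · by_cases h : x ∈ Ev r J
      · rw [Set.indicator_of_mem h]; exact if_pos h
      · rw [Set.indicator_of_notMem h]; exact if_neg h
  simp only [h1]
  haveI : IsFiniteMeasure (volume : Measure (Fin n → AddCircle (1:ℝ))) := by rw [volume_pi]; infer_instance
  rw [integral_finsetSum _ (fun J _ => (integrable_const (1:ℝ)).indicator (meas_Ev r J))]
  have h2 : ∀ J ∈ Finset.univ.powerset.filter (fun σ : Finset (Fin n) => σ.Nonempty),
      ∫ x, (Ev r J).indicator (fun _ => (1:ℝ)) x = F J.card := by
    intro J hJ
    have hne : J.Nonempty := by simpa using hJ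
    rw [integral_indicator_const _ (meas_Ev r J), smul_eq_mul, mul_one, Measure.real, vol_Ev r hr0 hr1 J hne,
      ENNReal.toReal_ofReal (by positivity)]
    simp only [F]
    rw [if_neg hne.card_pos.ne']
  rw [Finset.sum_congr rfl h2]
  have h3 : ∑ J ∈ Finset.univ.powerset.filter (fun σ : Finset (Fin n) => σ.Nonempty), F J.card
      = ∑ J ∈ (Finset.univ : Finset (Fin n)).powerset, F J.card := by
    refine Finset.sum_subset (Finset.filter_subset _ _) fun J hJ hJ' => ?_
    have : J = ∅ := by simpa [Finset.not_nonempty_iff_eq_empty] using hJ'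
    simp [this, F]
  rw [h3, Finset.sum_powerset_apply_card, Finset.card_univ, Fintype.card_fin]
  -- compare the two ranges
  have hfl : 1 ≤ ⌊1 / r⌋₊ := by
    rw [Nat.one_le_floor_iff]
    rw [le_div_iff₀ hr0]; linarith
  have h4 : ∑ k ∈ Finset.range (n + 1), n.choose k • F k
      = ∑ k ∈ Finset.range (n + 1 + ⌊1 / r⌋₊ + 1), n.choose k • F k := by
    refine Finset.sum_subset (fun k hk => ?_) fun k _ hk' => ?_
    · simp at hk ⊢; omega
    · rw [Nat.choose_eq_zero_of_lt (by simpa using hk'), zero_smul]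
  rw [h4]
  symm
  have h5 : ∀ k ∈ Finset.Icc 1 ⌊1 / r⌋₊, (n.choose k : ℝ) * (1 - k * r) ^ (k - 1) * (k * r) ^ (n - k) = n.choose k • F k := by
    intro k hk
    rw [Finset.mem_Icc] at hk
    have hkr : (k:ℝ) * r ≤ 1 := by
      have := (Nat.le_floor_iff (by positivity)).1 hk.2
      rwa [le_div_iff₀ hr0] at this
    simp only [F]
    rw [if_neg (by omega), max_eq_left (by linarith), nsmul_eq_mul, mul_assoc]
  rw [Finset.sum_congr rfl h5]
  refine Finset.sum_subset (fun k hk => ?_) fun k _ hk' => ?_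
  · simp at hk ⊢; omega
  · by_cases h0 : k = 0
    · simp [h0, F]
    · have hk2 : ⌊1 / r⌋₊ < k := by
        rw [Finset.mem_Icc] at hk'; omega
      have := (Nat.floor_lt (by positivity)).1 hk2
      rw [div_lt_iff₀ hr0] at this
      simp only [F]
      rw [if_neg h0, max_eq_right (by linarith), zero_pow (by omega), zero_mul, smul_zero]
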